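/- Let f : [0,∞) → [0,∞) be monotone nondecreasing and for t ≥ 0 set Λ(t) = ∫₀ᵗ e^{-(t-u)} f(u) du. Then ∫₀^∞ e^{-f(t)} f(t) dt = ∞ if and only if ∫₀^∞ e^{-Λ(t)} (1 − e^{-t}) f(t) dt = ∞. -/

import Mathlib

open MeasureTheory Real

lemma integral_exp_neg_sub_mul_eq (F : ℝ → ℝ) (t : ℝ) :
    ∫ u in (0:ℝ)..t, exp (-(t - u)) * F u = exp (-t) * ∫ u in (0:ℝ)..t, exp u * F u := by
  rw [← intervalIntegral.integral_const_mul]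
  congr 1 with u
  rw [← mul_assoc, ← exp_add]
  ring_nf

lemma Monotone.intervalIntegrable_exp_mul {F : ℝ → ℝ} (hF : Monotone F) (a b : ℝ) :
    IntervalIntegrable (fun u => exp u * F u) volume a b :=
  hF.intervalIntegrable.continuousOn_mul continuous_exp.continuousOn

lemma Monotone.continuous_integral_exp_neg_sub_mul {F : ℝ → ℝ} (hF : Monotone F) :
    Continuous fun t => ∫ u in (0:ℝ)..t, exp (-(t - u)) * F u := by
  simp_rw [integral_exp_neg_sub_mul_eq]
  exact (continuous_exp.comp continuous_neg).mul
    (intervalIntegral.continuous_primitive hF.intervalIntegrable_exp_mul 0)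

lemma Monotone.hasDerivAt_integral_exp_neg_sub_mul {F : ℝ → ℝ} (hF : Monotone F) {t : ℝ}
    (ht : ContinuousAt F t) :
    HasDerivAt (fun t => ∫ u in (0:ℝ)..t, exp (-(t - u)) * F u)
      (F t - ∫ u in (0:ℝ)..t, exp (-(t - u)) * F u) t := by
  simp_rw [integral_exp_neg_sub_mul_eq]
  have hprim : HasDerivAt (fun t => ∫ u in (0:ℝ)..t, exp u * F u) (exp t * F t) t :=
    intervalIntegral.integral_hasDerivAt_right (hF.intervalIntegrable_exp_mul 0 t)
      (measurable_exp.mul hF.measurable).stronglyMeasurable.stronglyMeasurableAtFilter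
      (continuous_exp.continuousAt.mul ht)
  refine ((hasDerivAt_neg t).exp.mul hprim).congr_deriv ?_
  rw [← mul_assoc, ← exp_add, neg_add_cancel, exp_zero]
  ring

lemma Monotone.integral_exp_neg_sub_mul_le {F : ℝ → ℝ} (hF : Monotone F) (h0 : ∀ t, 0 ≤ F t)
    {t : ℝ} (ht : 0 ≤ t) : ∫ u in (0:ℝ)..t, exp (-(t - u)) * F u ≤ F t := by
  rw [integral_exp_neg_sub_mul_eq]
  have hle : ∫ u in (0:ℝ)..t, exp u * F u ≤ ∫ u in (0:ℝ)..t, exp u * F t :=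
    intervalIntegral.integral_mono_on ht (hF.intervalIntegrable_exp_mul 0 t)
      ((continuous_exp.mul continuous_const).intervalIntegrable _ _)
      fun u hu => mul_le_mul_of_nonneg_left (hF hu.2) (exp_pos u).le
  rw [intervalIntegral.integral_mul_const, integral_exp, exp_zero] at hle
  calc exp (-t) * ∫ u in (0:ℝ)..t, exp u * F u
      ≤ exp (-t) * ((exp t - 1) * F t) := mul_le_mul_of_nonneg_left hle (exp_pos _).le
    _ = (1 - exp (-t)) * F t := by
        rw [← mul_assoc, mul_sub, ← exp_add]; simp
    _ ≤ F t := mul_le_of_le_one_left (h0 t) (by linarith [exp_pos (-t)])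

lemma integral_exp_neg_sub_mul_nonneg {F : ℝ → ℝ} (h0 : ∀ t, 0 ≤ F t) {t : ℝ} (ht : 0 ≤ t) :
    0 ≤ ∫ u in (0:ℝ)..t, exp (-(t - u)) * F u :=
  intervalIntegral.integral_nonneg ht fun u _ => mul_nonneg (exp_pos _).le (h0 u)

/-- If `L' = F - L` then `(L + 1) e^{-L} (F - L)` is the derivative of `-(L + 2) e^{-L}`, so its
integral stays bounded. -/
lemma Monotone.integrableOn_exp_neg_mul_sub {F : ℝ → ℝ} (hF : Monotone F) (h0 : ∀ t, 0 ≤ F t)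
    {L : ℝ → ℝ} (hL : ∀ t, L t = ∫ u in (0:ℝ)..t, exp (-(t - u)) * F u) :
    IntegrableOn (fun t => exp (-L t) * (L t + 1) * (F t - L t)) (Set.Ioi 0) := by
  obtain rfl : L = fun t => ∫ u in (0:ℝ)..t, exp (-(t - u)) * F u := funext hL
  set L : ℝ → ℝ := fun t => ∫ u in (0:ℝ)..t, exp (-(t - u)) * F u
  have hc : Continuous L := hF.continuous_integral_exp_neg_sub_mul
  have hint (a b : ℝ) :
      IntervalIntegrable (fun t => exp (-L t) * (L t + 1) * (F t - L t)) volume a b :=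
    (hF.intervalIntegrable.sub (hc.intervalIntegrable a b)).continuousOn_mul
      (by fun_prop : Continuous fun t => exp (-L t) * (L t + 1)).continuousOn
  refine integrableOn_Ioi_of_intervalIntegral_norm_bounded 2 0 (b := id) (l := Filter.atTop)
    (fun T => ?_) Filter.tendsto_id ?_
  · exact (le_or_gt 0 T).elim
      (fun hT => (intervalIntegrable_iff_integrableOn_Ioc_of_le hT).1 (hint 0 T))
      (fun hT => by simp [Set.Ioc_eq_empty_of_le hT.le])
  · filter_upwards [Filter.eventually_ge_atTop 0] with T hT
    have hftc := integral_eq_of_hasDerivAt_off_countable_of_le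
      (fun t => -(L t + 2) * exp (-L t)) (fun t => exp (-L t) * (L t + 1) * (F t - L t)) hT
      hF.countable_not_continuousAt (by fun_prop : Continuous _).continuousOn
      (fun t ht => by
        have hd : HasDerivAt L (F t - L t) t :=
          hF.hasDerivAt_integral_exp_neg_sub_mul (not_not.1 ht.2)
        refine ((hd.add_const 2).neg.mul hd.neg.exp).congr_deriv ?_
        simp only [Pi.neg_apply]
        ring)
      (hint 0 T)
    have hnorm : ∫ t in (0:ℝ)..T, ‖exp (-L t) * (L t + 1) * (F t - L t)‖
        = ∫ t in (0:ℝ)..T, exp (-L t) * (L t + 1) * (F t - L t) := by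
      refine intervalIntegral.integral_congr fun t ht => norm_of_nonneg ?_
      rw [Set.uIcc_of_le hT] at ht
      have h1 : 0 ≤ L t := integral_exp_neg_sub_mul_nonneg h0 ht.1
      have h2 : L t ≤ F t := hF.integral_exp_neg_sub_mul_le h0 ht.1
      exact mul_nonneg (by positivity) (sub_nonneg.2 h2)
    have hL0 : L 0 = 0 := intervalIntegral.integral_same
    have hLT : 0 ≤ L T := integral_exp_neg_sub_mul_nonneg h0 hT
    simp only [id]
    rw [hnorm, hftc, hL0]
    have : 0 ≤ (L T + 2) * exp (-L T) := by positivity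
    simp only [neg_zero, exp_zero]
    linarith

/-- For `0 ≤ y ≤ x`, either `x - y ≤ 1` and the first term dominates, or `x - y ≥ 1` and the
second one does. -/
lemma exp_neg_mul_le_add {x y : ℝ} (hy : 0 ≤ y) (hyx : y ≤ x) :
    exp (-y) * x ≤ exp 1 * (exp (-x) * x) + exp (-y) * (y + 1) * (x - y) := by
  rcases le_total (x - y) 1 with h | h
  · have h1 : exp (-y) ≤ exp 1 * exp (-x) := by
      rw [← exp_add]; exact exp_le_exp.2 (by linarith)
    have h2 : 0 ≤ exp (-y) * (y + 1) * (x - y) :=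
      mul_nonneg (by positivity) (sub_nonneg.2 hyx)
    nlinarith [mul_le_mul_of_nonneg_right h1 (hy.trans hyx)]
  · have h1 : x ≤ (y + 1) * (x - y) := by nlinarith
    have h2 : 0 ≤ exp 1 * (exp (-x) * x) :=
      mul_nonneg (exp_pos _).le (mul_nonneg (exp_pos _).le (hy.trans hyx))
    nlinarith [mul_le_mul_of_nonneg_left h1 (exp_pos (-y)).le]

lemma exp_neg_mul_self_le_one (x : ℝ) : exp (-x) * x ≤ 1 := by
  rw [exp_neg, inv_mul_le_one₀ (exp_pos x)]
  linarith [add_one_le_exp x]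

/-- For `f : [0,∞) → [0,∞)` monotone nondecreasing and `Λ(t) = ∫₀ᵗ e^{-(t-u)} f(u) du`,
`∫₀^∞ e^{-f(t)} f(t) dt = ∞` if and only if `∫₀^∞ e^{-Λ(t)} (1 − e^{-t}) f(t) dt = ∞`. -/
theorem frog_integral_iff (f Λ : ℝ → ℝ)
    (hf_nonneg : ∀ t, 0 ≤ t → 0 ≤ f t)
    (hf_mono : MonotoneOn f (Set.Ici (0 : ℝ)))
    (hΛ : ∀ t, Λ t = ∫ u in (0:ℝ)..t, Real.exp (-(t - u)) * f u) :
    (∫⁻ t in Set.Ioi (0:ℝ), ENNReal.ofReal (Real.exp (-f t) * f t)) = ⊤ ↔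
      (∫⁻ t in Set.Ioi (0:ℝ),
        ENNReal.ofReal (Real.exp (-Λ t) * (1 - Real.exp (-t)) * f t)) = ⊤ := by
  set F : ℝ → ℝ := fun t => f (max t 0) with hFdef
  have hFf {t : ℝ} (ht : 0 ≤ t) : F t = f t := by simp [hFdef, ht]
  have hF : Monotone F := fun a b hab =>
    hf_mono (le_max_right a 0) (le_max_right b 0) (max_le_max_right 0 hab)
  have h0 (t : ℝ) : 0 ≤ F t := hf_nonneg _ (le_max_right t 0)
  set L : ℝ → ℝ := fun t => ∫ u in (0:ℝ)..t, exp (-(t - u)) * F u with hLdef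
  have hΛL {t : ℝ} (ht : 0 ≤ t) : Λ t = L t := by
    rw [hΛ]
    refine intervalIntegral.integral_congr fun u hu => ?_
    rw [Set.uIcc_of_le ht] at hu
    simp only [hFf hu.1]
  have hL0 {t : ℝ} (ht : 0 ≤ t) : 0 ≤ L t := integral_exp_neg_sub_mul_nonneg h0 ht
  have hLF {t : ℝ} (ht : 0 ≤ t) : L t ≤ F t := hF.integral_exp_neg_sub_mul_le h0 ht
  have hFm : Measurable F := hF.measurable
  have hcongr₁ : ∫⁻ t in Set.Ioi (0:ℝ), ENNReal.ofReal (exp (-f t) * f t)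
      = ∫⁻ t in Set.Ioi (0:ℝ), ENNReal.ofReal (exp (-F t) * F t) :=
    setLIntegral_congr_fun measurableSet_Ioi fun t (ht : 0 < t) => by simp only [hFf ht.le]
  have hcongr₂ : ∫⁻ t in Set.Ioi (0:ℝ), ENNReal.ofReal (exp (-Λ t) * (1 - exp (-t)) * f t)
      = ∫⁻ t in Set.Ioi (0:ℝ), ENNReal.ofReal (exp (-L t) * (1 - exp (-t)) * F t) :=
    setLIntegral_congr_fun measurableSet_Ioi fun t (ht : 0 < t) => by
      simp only [hFf ht.le, hΛL ht.le]
  rw [hcongr₁, hcongr₂]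
  constructor <;> intro h <;> contrapose! h
  · rw [← Set.Ioc_union_Ioi_eq_Ioi zero_le_one,
      lintegral_union measurableSet_Ioi (Set.Ioc_disjoint_Ioi le_rfl)]
    refine ENNReal.add_ne_top.2 ⟨ne_top_of_le_ne_top (b := 1) ENNReal.one_ne_top ?_, ?_⟩
    · calc ∫⁻ t in Set.Ioc (0:ℝ) 1, ENNReal.ofReal (exp (-F t) * F t)
          ≤ ∫⁻ _ in Set.Ioc (0:ℝ) 1, 1 :=
            lintegral_mono fun t => ENNReal.ofReal_le_one.2 (exp_neg_mul_self_le_one _)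
        _ = 1 := by simp
    · have hc : 0 < 1 - exp (-1) := by
        rw [sub_pos, exp_lt_one_iff]; norm_num
      refine ne_top_of_le_ne_top
        (ENNReal.mul_ne_top (ENNReal.ofReal_ne_top (r := (1 - exp (-1))⁻¹)) h) ?_
      rw [← lintegral_const_mul' _ _ ENNReal.ofReal_ne_top]
      refine (setLIntegral_mono' measurableSet_Ioi fun t ht => ?_).trans
        (lintegral_mono_set (Set.Ioi_subset_Ioi zero_le_one))
      have ht : (1:ℝ) < t := ht
      have ht0 : 0 ≤ t := by linarith
      rw [← ENNReal.ofReal_mul (inv_nonneg.2 hc.le)]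
      refine ENNReal.ofReal_le_ofReal ?_
      rw [le_inv_mul_iff₀ hc, ← mul_assoc, mul_comm (1 - exp (-1))]
      have h1 : exp (-t) ≤ exp (-1) := exp_le_exp.2 (by linarith)
      have h2 : exp (-F t) ≤ exp (-L t) := exp_le_exp.2 (by linarith [hLF ht0])
      have h3 := h0 t
      gcongr
  · have hint := (hF.integrableOn_exp_neg_mul_sub h0 (L := L) fun _ => rfl).lintegral_lt_top.ne
    refine ne_top_of_le_ne_top (ENNReal.add_ne_top.2
      ⟨ENNReal.mul_ne_top (ENNReal.ofReal_ne_top (r := exp 1)) h, hint⟩) ?_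
    rw [← lintegral_const_mul' _ _ ENNReal.ofReal_ne_top,
      ← lintegral_add_left (by fun_prop)]
    refine setLIntegral_mono' measurableSet_Ioi fun t ht => ?_
    have ht : 0 ≤ t := le_of_lt ht
    have h1 : 0 ≤ exp (-F t) * F t := mul_nonneg (exp_pos _).le (h0 t)
    have h2 : 0 ≤ exp (-L t) * (L t + 1) * (F t - L t) :=
      mul_nonneg (mul_nonneg (exp_pos _).le (by linarith [hL0 ht])) (sub_nonneg.2 (hLF ht))
    rw [← ENNReal.ofReal_mul (exp_pos 1).le, ← ENNReal.ofReal_add (by positivity) h2]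
    refine ENNReal.ofReal_le_ofReal (le_trans ?_ (exp_neg_mul_le_add (hL0 ht) (hLF ht)))
    exact mul_le_mul_of_nonneg_right
      (mul_le_of_le_one_right (exp_pos _).le (by linarith [exp_pos (-t)])) (h0 t)
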